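/- arXiv:1104.0872 — 3 statements merged into one kernel-verified Lean document; each statement's English description precedes it below -/
import Mathlib

section
/- There is a constant c (depending only on the universal machine) such that for all positive integers n, m, k ≥ 2, letting K = 2^{k+1} − 1, there exists a string x ∈ {0,1}^n with C(x) > n − K·log₂(2^m + 1) such that every string z ∈ {0,1}^m with C(z | x) ≤ k has C(z) ≤ k + log₂ n + log₂ m + c·(log₂ log₂ n + log₂ log₂ m) + c. -/
/-- Binary strings. -/
abbrev Str := List Bool

/-- `U` is an optimal universal conditional machine: it is partial computable and,
for every partial computable `M`, programs for `M` can be translated to programs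
for `U` with only a constant-length overhead. -/
def UniversalM (U : Str × Str →. Str) : Prop :=
  Partrec U ∧
    ∀ M : Str × Str →. Str, Partrec M →
      ∃ c : ℕ, ∀ x y p : Str, x ∈ M (p, y) →
        ∃ q : Str, x ∈ U (q, y) ∧ q.length ≤ p.length + c

/-- Conditional plain Kolmogorov complexity `C(x|y)` with respect to `U`. -/
noncomputable def KC (U : Str × Str →. Str) (x y : Str) : ℕ :=
  sInf {l : ℕ | ∃ p : Str, p.length = l ∧ x ∈ U (p, y)}

/-- Unconditional plain complexity `C(x) = C(x|λ)`. -/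
noncomputable def KC0 (U : Str × Str →. Str) (x : Str) : ℕ := KC U x []

/-- Complexity conditioned on (the binary representation of) a natural number. -/
noncomputable def KCn (U : Str × Str →. Str) (x : Str) (n : ℕ) : ℕ := KC U x (Nat.bits n)

/-- The list of all binary strings of length `n`. -/
def strs : ℕ → List Str
  | 0 => [[]]
  | n + 1 => (strs n).map (List.cons false) ++ (strs n).map (List.cons true)

theorem mem_strs {n : ℕ} {x : Str} : x ∈ strs n ↔ x.length = n := by
  induction n generalizing x with
  | zero => simp [strs]
  | succ n ih =>
    rcases x with _ | ⟨b, x⟩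
    · simp [strs]
    · cases b <;> simp [strs, ih]

theorem nodup_strs (n : ℕ) : (strs n).Nodup := by
  induction n with
  | zero => simp [strs]
  | succ n ih =>
    refine List.Nodup.append (ih.map List.cons_injective) (ih.map List.cons_injective) ?_
    intro x hx hy
    simp only [List.mem_map] at hx hy
    obtain ⟨u, -, rfl⟩ := hx
    obtain ⟨v, -, h⟩ := hy
    simp at h

theorem length_strs (n : ℕ) : (strs n).length = 2 ^ n := by
  induction n with
  | zero => simp [strs]
  | succ n ih => simp [strs, ih, pow_succ, mul_two]

theorem primrec_strs : Primrec strs := by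
  refine (Primrec.nat_rec₁ (f := fun _ (L : List Str) =>
    L.map (List.cons false) ++ L.map (List.cons true)) [[]] ?_).of_eq ?_
  · exact Primrec.list_append.comp
      (Primrec.list_map Primrec.snd
        (Primrec.list_cons.comp (Primrec.const false) Primrec.snd).to₂)
      (Primrec.list_map Primrec.snd
        (Primrec.list_cons.comp (Primrec.const true) Primrec.snd).to₂)
  · intro n
    induction n with
    | zero => rfl
    | succ n ih => simp only [strs, ← ih]

/-- The list of all binary strings of length at most `k`. -/
def strsLE (k : ℕ) : List Str := (List.range (k + 1)).flatMap strs

theorem mem_strsLE {k : ℕ} {x : Str} : x ∈ strsLE k ↔ x.length ≤ k := by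
  simp [strsLE, mem_strs]

theorem length_strsLE (k : ℕ) : (strsLE k).length = 2 ^ (k + 1) - 1 := by
  have h : (strsLE k).length + 1 = 2 ^ (k + 1) := by
    induction k with
    | zero => simp [strsLE, strs]
    | succ k ih =>
      unfold strsLE at ih ⊢
      rw [List.range_succ, List.flatMap_append, List.length_append]
      simp only [List.flatMap_singleton, length_strs]
      rw [pow_succ 2 (k + 1)]
      omega
  omega

theorem primrec_strsLE : Primrec strsLE :=
  Primrec.list_flatMap (Primrec.list_range.comp Primrec.succ) (primrec_strs.comp Primrec.snd).to₂

/-- The position of `s` among the strings of its length. -/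
def strVal (s : Str) : ℕ := (strs s.length).idxOf s

/-- The string of length `n` at position `j` among the strings of its length. -/
def strRep (n j : ℕ) : Str := (strs n)[j]?.getD []

theorem strRep_mem {n j : ℕ} (h : j < 2 ^ n) : strRep n j ∈ strs n := by
  have h' : j < (strs n).length := by rwa [length_strs]
  simp [strRep, h']

theorem length_strRep {n j : ℕ} (h : j < 2 ^ n) : (strRep n j).length = n :=
  mem_strs.1 (strRep_mem h)

theorem strVal_strRep {n j : ℕ} (h : j < 2 ^ n) : strVal (strRep n j) = j := by
  have h' : j < (strs n).length := by rwa [length_strs]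
  rw [strVal, length_strRep h]
  simp only [strRep, List.getElem?_eq_getElem h', Option.getD_some]
  exact (nodup_strs n).idxOf_getElem j h'

theorem primrec_strVal : Primrec strVal :=
  (Primrec.list_idxOf.comp Primrec.id (primrec_strs.comp Primrec.list_length)).of_eq fun s => by
    simp only [strVal, id]
    congr!

/-- A self-delimiting encoding of natural numbers. -/
def selfDelim (N : ℕ) : Str :=
  List.replicate N.size.size true ++ false :: (strRep N.size.size N.size ++ strRep N.size N)

/-- Reads a self-delimiting encoding off the front of a string and returns the remainder. -/
def readNat (p : Str) : ℕ × Str :=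
  let r := p.drop (p.idxOf false + 1)
  let s := r.drop (p.idxOf false)
  let len := strVal (r.take (p.idxOf false))
  (strVal (s.take len), s.drop len)

theorem readNat_selfDelim (N : ℕ) (r : Str) : readNat (selfDelim N ++ r) = (N, r) := by
  have h₁ : N < 2 ^ N.size := Nat.lt_size_self N
  have h₂ : N.size < 2 ^ N.size.size := Nat.lt_size_self _
  have l₁ := length_strRep h₁
  have l₂ := length_strRep h₂
  have hi : (selfDelim N ++ r).idxOf false = N.size.size := by
    rw [selfDelim, List.append_assoc, List.idxOf_append_of_notMem (by simp)]
    simp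
  have hd : (selfDelim N ++ r).drop (N.size.size + 1) =
      strRep N.size.size N.size ++ (strRep N.size N ++ r) := by
    have : selfDelim N ++ r = (List.replicate N.size.size true ++ [false]) ++
        (strRep N.size.size N.size ++ (strRep N.size N ++ r)) := by
      simp [selfDelim]
    rw [this]
    exact List.drop_left' (by simp)
  simp only [readNat, hi, hd, List.take_left' l₂, List.drop_left' l₂, strVal_strRep h₂,
    List.take_left' l₁, List.drop_left' l₁, strVal_strRep h₁]

theorem length_selfDelim (N : ℕ) : (selfDelim N).length = 2 * N.size.size + 1 + N.size := by
  simp [selfDelim, length_strRep (Nat.lt_size_self N), length_strRep (Nat.lt_size_self N.size)]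
  omega

theorem primrec_readNat : Primrec readNat := by
  have hi : Primrec fun p : Str => p.idxOf false :=
    Primrec.list_idxOf.comp (Primrec.const false) Primrec.id
  have hr : Primrec fun p : Str => p.drop (p.idxOf false + 1) :=
    Primrec.list_drop.comp (Primrec.succ.comp hi) Primrec.id
  have hs := Primrec.list_drop.comp hi hr
  have hl := primrec_strVal.comp (Primrec.list_take.comp hi hr)
  exact (primrec_strVal.comp (Primrec.list_take.comp hl hs)).pair (Primrec.list_drop.comp hl hs)

theorem logb_size_le {N : ℕ} (h : 1 ≤ N) : (N.size : ℝ) ≤ Real.logb 2 N + 1 := by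
  have h₁ : 0 < N.size := Nat.size_pos.2 h
  have h₂ : 2 ^ (N.size - 1) ≤ N := Nat.lt_size.1 (by omega)
  have h₃ : ((N.size - 1 : ℕ) : ℝ) ≤ Real.logb 2 N := by
    rw [Real.le_logb_iff_rpow_le (by norm_num) (by exact_mod_cast h), Real.rpow_natCast]
    exact_mod_cast h₂
  rw [Nat.cast_sub (by omega)] at h₃
  push_cast at h₃
  linarith

theorem one_le_logb_two {N : ℕ} (h : 2 ≤ N) : 1 ≤ Real.logb 2 N := by
  rw [Real.le_logb_iff_rpow_le (by norm_num) (by positivity), Real.rpow_one]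
  exact_mod_cast h

theorem logb_logb_two_nonneg {N : ℕ} (h : 2 ≤ N) : 0 ≤ Real.logb 2 (Real.logb 2 N) :=
  Real.logb_nonneg (by norm_num) (one_le_logb_two h)

theorem length_selfDelim_le {N : ℕ} (h : 2 ≤ N) :
    ((selfDelim N).length : ℝ) ≤
      Real.logb 2 N + 2 * Real.logb 2 (Real.logb 2 N) + 6 := by
  have h₁ := logb_size_le (show 1 ≤ N by omega)
  have hs : 1 ≤ N.size := Nat.size_pos.2 (by omega)
  have h₂ := logb_size_le hs
  have h₃ := one_le_logb_two h
  have h₄ : Real.logb 2 (N.size : ℝ) ≤ Real.logb 2 (2 * Real.logb 2 N) :=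
    Real.logb_le_logb_of_le (by norm_num) (by exact_mod_cast hs) (by linarith)
  rw [Real.logb_mul (by norm_num) (by linarith), Real.logb_self_eq_one (by norm_num)] at h₄
  rw [length_selfDelim]
  push_cast
  linarith

theorem length_selfDelim_mono {M N : ℕ} (h : M ≤ N) :
    (selfDelim M).length ≤ (selfDelim N).length := by
  have h₁ := Nat.size_le_size h
  have h₂ := Nat.size_le_size h₁
  rw [length_selfDelim, length_selfDelim]
  omega

theorem Primrec₂.pow : Primrec₂ ((· ^ ·) : ℕ → ℕ → ℕ) := by
  refine (Primrec.nat_rec (f := fun _ : ℕ => 1) (g := fun a (q : ℕ × ℕ) => q.2 * a)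
    (Primrec.const 1) (Primrec.nat_mul.comp (Primrec.snd.comp Primrec.snd) Primrec.fst)).of_eq ?_
  intro a n
  induction n with
  | zero => rfl
  | succ n ih => simp only [pow_succ, ← ih]

section Chain

variable (R : ℕ → Str → Str → Str → Prop)

/-- `Covers R P t l x`: within `t` steps, every element of `l` is produced from `x` by
some program in the list `P`. -/
def Covers (P : List Str) (t : ℕ) (l : List Str) (x : Str) : Prop :=
  ∀ v ∈ l, ∃ p ∈ P, R t p x v

open Classical in
/-- An element of `W` outside `l` that can be added to `l` while keeping, within `t` steps,
a `1 / (#W + 1) ^ (#l + 1)` fraction of the elements of `X` covered. -/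
noncomputable def nextElem (X W P : List Str) (t : ℕ) (l : List Str) : Option Str :=
  (W.filter fun w => w ∉ l ∧
    X.length ≤ (X.filter fun x => Covers R P t (w :: l) x).length *
      (W.length + 1) ^ (l.length + 1)).head?

/-- Iterating `nextElem`, waiting as long as necessary for each new element. -/
noncomputable def chain (X W P : List Str) (j : ℕ) : Part (List Str) :=
  Nat.rec (Part.some []) (fun _ IH => IH.bind fun l =>
    (Nat.rfindOpt fun t => nextElem R X W P t l).map fun w => w :: l) j

variable {R}

theorem primrec_nextElem
    (hR : PrimrecPred fun q : ℕ × Str × Str × Str => R q.1 q.2.1 q.2.2.1 q.2.2.2) :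
    Primrec fun q : (List Str × List Str × List Str) × List Str × ℕ =>
      nextElem R q.1.1 q.1.2.1 q.1.2.2 q.2.2 q.2.1 := by
  classical
  have h₁ : PrimrecRel fun (p : Str) (b : ℕ × Str × Str) => R b.1 p b.2.1 b.2.2 :=
    hR.comp ((Primrec.fst.comp Primrec.snd).pair (Primrec.fst.pair (Primrec.snd.comp Primrec.snd)))
  have h₂ : PrimrecRel fun (v : Str) (b : List Str × ℕ × Str) =>
      ∃ p ∈ b.1, R b.2.1 p b.2.2 v :=
    h₁.exists_mem_list.comp (Primrec.fst.comp Primrec.snd)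
      ((Primrec.fst.comp (Primrec.snd.comp Primrec.snd)).pair
        ((Primrec.snd.comp (Primrec.snd.comp Primrec.snd)).pair Primrec.fst))
  have h₃ : PrimrecRel fun (x : Str) (b : List Str × ℕ × List Str) =>
      Covers R b.1 b.2.1 b.2.2 x :=
    h₂.forall_mem_list.comp (Primrec.snd.comp (Primrec.snd.comp Primrec.snd))
      ((Primrec.fst.comp Primrec.snd).pair
        ((Primrec.fst.comp (Primrec.snd.comp Primrec.snd)).pair Primrec.fst))
  have h₄ := h₃.listFilter
  have h₅ : PrimrecRel fun (w : Str) (l : List Str) => w ∈ l :=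
    (Primrec.eq.exists_mem_list.comp Primrec.snd Primrec.fst).of_eq fun b => by simp
  have h₆ : PrimrecRel fun (w : Str)
      (q : (List Str × List Str × List Str) × List Str × ℕ) => w ∉ q.2.1 ∧
      q.1.1.length ≤ (q.1.1.filter fun x => Covers R q.1.2.2 q.2.2 (w :: q.2.1) x).length *
        (q.1.2.1.length + 1) ^ (q.2.1.length + 1) := by
    have e := Primrec.snd (α := Str) (β := (List Str × List Str × List Str) × List Str × ℕ)
    have eX := Primrec.fst.comp (Primrec.fst.comp e)
    have eW := Primrec.fst.comp (Primrec.snd.comp (Primrec.fst.comp e))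
    have eP := Primrec.snd.comp (Primrec.snd.comp (Primrec.fst.comp e))
    have el := Primrec.fst.comp (Primrec.snd.comp e)
    have et := Primrec.snd.comp (Primrec.snd.comp e)
    refine PrimrecPred.and (PrimrecPred.not (h₅.comp Primrec.fst el)) ?_
    refine Primrec.nat_le.comp (Primrec.list_length.comp eX) (Primrec.nat_mul.comp ?_ ?_)
    · exact Primrec.list_length.comp
        (h₄.comp eX (eP.pair (et.pair (Primrec.list_cons.comp Primrec.fst el))))
    · exact Primrec₂.pow.comp (Primrec.succ.comp (Primrec.list_length.comp eW))
        (Primrec.succ.comp (Primrec.list_length.comp el))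
  exact Primrec.list_head?.comp
    (h₆.listFilter.comp (Primrec.fst.comp (Primrec.snd.comp Primrec.fst)) Primrec.id)

theorem partrec_chain
    (hR : PrimrecPred fun q : ℕ × Str × Str × Str => R q.1 q.2.1 q.2.2.1 q.2.2.2) :
    Partrec fun q : (List Str × List Str × List Str) × ℕ =>
      chain R q.1.1 q.1.2.1 q.1.2.2 q.2 := by
  have h₁ : Computable₂ fun (q : (List Str × List Str × List Str) × List Str) (t : ℕ) =>
      nextElem R q.1.1 q.1.2.1 q.1.2.2 t q.2 :=
    ((primrec_nextElem hR).comp ((Primrec.fst.comp Primrec.fst).pair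
      ((Primrec.snd.comp Primrec.fst).pair Primrec.snd))).to_comp
  have h₂ : Partrec fun q : (List Str × List Str × List Str) × List Str =>
      (Nat.rfindOpt fun t => nextElem R q.1.1 q.1.2.1 q.1.2.2 t q.2).map fun w => w :: q.2 :=
    (Partrec.rfindOpt h₁).map
      (Computable.list_cons.comp Computable.snd (Computable.snd.comp Computable.fst)).to₂
  exact Partrec.nat_rec Computable.snd (Partrec.const' (Part.some []))
    (h₂.comp ((Computable.fst.comp Computable.fst).pair
      (Computable.snd.comp Computable.snd))).to₂

end Chain

section Selection

variable {R : ℕ → Str → Str → Str → Prop}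

/-- Some program in the list `P` eventually produces `v` from `x`. -/
def Hits (R : ℕ → Str → Str → Str → Prop) (P : List Str) (x v : Str) : Prop :=
  ∃ p ∈ P, ∃ t, R t p x v

open Classical in
/-- The elements of `X` from which every element of `l` is eventually produced. -/
noncomputable def covered (R : ℕ → Str → Str → Str → Prop) (X P l : List Str) : Finset Str :=
  X.toFinset.filter fun x => ∀ v ∈ l, Hits R P x v

theorem mem_covered {X P l : List Str} {x : Str} :
    x ∈ covered R X P l ↔ x ∈ X ∧ ∀ v ∈ l, Hits R P x v := by
  simp [covered]

theorem exists_covers (hmono : ∀ s t p x v, s ≤ t → R s p x v → R t p x v)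
    (X P l : List Str) : ∃ t, ∀ x ∈ covered R X P l, Covers R P t l x := by
  have h : ∀ᶠ t in Filter.atTop, ∀ x ∈ covered R X P l, ∀ v ∈ l.toFinset, ∃ p ∈ P, R t p x v := by
    rw [Filter.eventually_all_finset]
    intro x hx
    rw [Filter.eventually_all_finset]
    intro v hv
    obtain ⟨p, hp, s, hs⟩ := (mem_covered.1 hx).2 v (List.mem_toFinset.1 hv)
    filter_upwards [Filter.eventually_ge_atTop s] with t ht
    exact ⟨p, hp, hmono _ _ _ _ _ ht hs⟩
  obtain ⟨t, ht⟩ := h.exists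
  exact ⟨t, fun x hx v hv => ht x hx v (List.mem_toFinset.2 hv)⟩

open Classical in
theorem length_filter_covers_le {X : List Str} (hX : X.Nodup) (P l : List Str) (t : ℕ) :
    (X.filter fun x => Covers R P t l x).length ≤ (covered R X P l).card := by
  rw [← List.toFinset_card_of_nodup (hX.filter _)]
  refine Finset.card_le_card fun x hx => ?_
  simp only [List.mem_toFinset, List.mem_filter, decide_eq_true_eq] at hx
  refine mem_covered.2 ⟨hx.1, fun v hv => ?_⟩
  obtain ⟨p, hp, h⟩ := hx.2 v hv
  exact ⟨p, hp, t, h⟩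

open Classical in
theorem exists_card_covered_le (hmono : ∀ s t p x v, s ≤ t → R s p x v → R t p x v)
    (X P l : List Str) :
    ∃ t, (covered R X P l).card ≤ (X.filter fun x => Covers R P t l x).length := by
  obtain ⟨t, ht⟩ := exists_covers hmono X P l
  refine ⟨t, le_trans (Finset.card_le_card fun x hx => ?_) (List.toFinset_card_le _)⟩
  simp only [List.mem_toFinset, List.mem_filter, decide_eq_true_eq]
  exact ⟨(mem_covered.1 hx).1, ht x hx⟩

theorem length_le_of_mem_covered
    (hfun : ∀ s t p x v w, R s p x v → R t p x w → v = w)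
    {X P l : List Str} (hl : l.Nodup) {x : Str} (hx : x ∈ covered R X P l) :
    l.length ≤ P.length := by
  have h := (mem_covered.1 hx).2
  choose! f hf g hg using h
  rw [← List.toFinset_card_of_nodup hl]
  refine le_trans (Finset.card_le_card_of_injOn f ?_ ?_) (List.toFinset_card_le P)
  · intro v hv
    simpa using hf v (by simpa using hv)
  · intro v hv w hw hvw
    have h₁ := hg v (by simpa using hv)
    have h₂ := hg w (by simpa using hw)
    rw [hvw] at h₁
    exact hfun _ _ _ _ _ _ h₁ h₂

theorem mem_chain_succ {X W P l : List Str} {j : ℕ} :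
    l ∈ chain R X W P (j + 1) ↔ ∃ l' ∈ chain R X W P j,
      ∃ w ∈ Nat.rfindOpt fun t => nextElem R X W P t l', w :: l' = l := by
  simp [chain]

theorem chain_spec {X W P : List Str} (hX : X.Nodup) {j : ℕ} {l : List Str}
    (h : l ∈ chain R X W P j) :
    l.length = j ∧ l.Nodup ∧ X.length ≤ (covered R X P l).card * (W.length + 1) ^ j ∧
      ∀ w ∈ l, ∃ i < j, ∃ l', w :: l' ∈ chain R X W P (i + 1) := by
  classical
  induction j generalizing l with
  | zero =>
    have : l = [] := by simpa [chain] using h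
    subst this
    simp [covered, List.toFinset_card_of_nodup hX]
  | succ j ih =>
    have h' := h
    obtain ⟨l', hl', w, hw, rfl⟩ := mem_chain_succ.1 h
    obtain ⟨h₁, h₂, h₃, h₄⟩ := ih hl'
    obtain ⟨t, ht⟩ := Nat.rfindOpt_spec hw
    have := List.mem_of_head? ht
    simp only [List.mem_filter, decide_eq_true_eq] at this
    obtain ⟨-, hwl, hlen⟩ := this
    refine ⟨by simp [h₁], List.nodup_cons.2 ⟨hwl, h₂⟩, ?_, ?_⟩
    · rw [h₁] at hlen
      exact hlen.trans (Nat.mul_le_mul_right _ (length_filter_covers_le hX _ _ _))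
    · intro v hv
      rcases List.mem_cons.1 hv with rfl | hv
      · exact ⟨j, by omega, l', h'⟩
      · obtain ⟨i, hi, r, hr⟩ := h₄ v hv
        exact ⟨i, by omega, r, hr⟩

theorem chain_succ_dom (hmono : ∀ s t p x v, s ≤ t → R s p x v → R t p x v)
    {X W P l : List Str} {j : ℕ} (hl : l ∈ chain R X W P j) (hj : l.length = j)
    {w : Str} (hw : w ∈ W) (hwl : w ∉ l)
    (hc : X.length ≤ (covered R X P (w :: l)).card * (W.length + 1) ^ (j + 1)) :
    (chain R X W P (j + 1)).Dom := by
  classical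
  obtain ⟨t, ht⟩ := exists_card_covered_le hmono X P (w :: l)
  have hmem : w ∈ W.filter fun w => w ∉ l ∧
      X.length ≤ (X.filter fun x => Covers R P t (w :: l) x).length *
        (W.length + 1) ^ (l.length + 1) := by
    simp only [List.mem_filter, decide_eq_true_eq]
    rw [hj]
    exact ⟨hw, hwl, hc.trans (Nat.mul_le_mul_right _ ht)⟩
  have hdom : (Nat.rfindOpt fun t => nextElem R X W P t l).Dom := by
    rw [Nat.rfindOpt_dom]
    refine ⟨t, _, List.head?_eq_some_head (List.ne_nil_of_mem hmem)⟩
  rw [Part.dom_iff_mem]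
  exact ⟨_, mem_chain_succ.2 ⟨l, hl, _, Part.get_mem hdom, rfl⟩⟩

open Classical in
/-- The chain stops after at most `#P` steps, and at that point a large fraction of `X` only
produces elements of the chain. -/
theorem exists_chain_large (hmono : ∀ s t p x v, s ≤ t → R s p x v → R t p x v)
    (hfun : ∀ s t p x v w, R s p x v → R t p x w → v = w)
    {X W P : List Str} (hX : X.Nodup) (hX₀ : X ≠ []) :
    ∃ l : List Str, (∀ w ∈ l, ∃ i < P.length, ∃ l', w :: l' ∈ chain R X W P (i + 1)) ∧
      X.length ≤ (X.toFinset.filter fun x => ∀ w ∈ W, Hits R P x w → w ∈ l).card *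
        (W.length + 1) ^ P.length := by
  have hpos : 0 < X.length := List.length_pos_iff.2 hX₀
  have hle : ∀ j l, l ∈ chain R X W P j → j ≤ P.length := by
    intro j l hl
    obtain ⟨h₁, h₂, h₃, -⟩ := chain_spec hX hl
    have : 0 < (covered R X P l).card := by
      by_contra h
      simp only [not_lt, Nat.le_zero] at h
      rw [h, zero_mul] at h₃
      omega
    obtain ⟨x, hx⟩ := Finset.card_pos.1 this
    exact h₁ ▸ length_le_of_mem_covered hfun h₂ hx
  obtain ⟨j, hj, hj'⟩ : ∃ j, (chain R X W P j).Dom ∧ ¬ (chain R X W P (j + 1)).Dom := by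
    by_contra! h
    have hall : ∀ j, (chain R X W P j).Dom := by
      intro j
      induction j with
      | zero => exact trivial
      | succ j ih => exact h j ih
    have := hle _ _ (Part.get_mem (hall (P.length + 1)))
    omega
  obtain ⟨l, hl⟩ := Part.dom_iff_mem.1 hj
  obtain ⟨h₁, h₂, h₃, h₄⟩ := chain_spec hX hl
  have hjP := hle j l hl
  refine ⟨l, fun w hw => ?_, ?_⟩
  · obtain ⟨i, hi, h⟩ := h₄ w hw
    exact ⟨i, by omega, h⟩
  set G := X.toFinset.filter fun x => ∀ w ∈ W, Hits R P x w → w ∈ l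
  have hsub : covered R X P l ⊆
      G ∪ (W.toFinset.filter (· ∉ l)).biUnion fun w => covered R X P (w :: l) := by
    intro x hx
    obtain ⟨hxX, hxl⟩ := mem_covered.1 hx
    by_cases hG : ∀ w ∈ W, Hits R P x w → w ∈ l
    · exact Finset.mem_union_left _ (Finset.mem_filter.2 ⟨List.mem_toFinset.2 hxX, hG⟩)
    · push Not at hG
      obtain ⟨w, hwW, hw, hwl⟩ := hG
      refine Finset.mem_union_right _ (Finset.mem_biUnion.2 ⟨w, by simp [hwW, hwl], ?_⟩)
      exact mem_covered.2 ⟨hxX, List.forall_mem_cons.2 ⟨hw, hxl⟩⟩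
  have hcard : (covered R X P l).card ≤
      G.card + ∑ w ∈ W.toFinset.filter (· ∉ l), (covered R X P (w :: l)).card :=
    (Finset.card_le_card hsub).trans ((Finset.card_union_le _ _).trans
      (Nat.add_le_add_left Finset.card_biUnion_le _))
  rcases hjP.lt_or_eq with hlt | heq
  · have hsum : (∑ w ∈ W.toFinset.filter (· ∉ l), (covered R X P (w :: l)).card) *
        (W.length + 1) ^ (j + 1) ≤ W.length * X.length := by
      rw [Finset.sum_mul]
      refine (Finset.sum_le_card_nsmul _ _ X.length fun w hw => ?_).trans ?_
      · simp only [Finset.mem_filter, List.mem_toFinset] at hw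
        by_contra! hc
        exact hj' (chain_succ_dom hmono hl h₁ hw.1 hw.2 hc.le)
      · rw [smul_eq_mul]
        exact Nat.mul_le_mul_right _
          ((Finset.card_filter_le _ _).trans (List.toFinset_card_le _))
    have hG : X.length ≤ G.card * (W.length + 1) ^ (j + 1) := by
      have e₁ := Nat.mul_le_mul_right (W.length + 1) h₃
      have e₂ := Nat.mul_le_mul_right ((W.length + 1) ^ (j + 1)) hcard
      rw [add_mul] at e₂
      rw [mul_assoc, ← pow_succ] at e₁
      nlinarith
    exact hG.trans (Nat.mul_le_mul_left _ (Nat.pow_le_pow_right (by omega) hlt))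
  · have hsum : ∑ w ∈ W.toFinset.filter (· ∉ l), (covered R X P (w :: l)).card = 0 := by
      refine Finset.sum_eq_zero fun w hw => ?_
      rw [Finset.card_eq_zero, Finset.eq_empty_iff_forall_notMem]
      intro x hx
      have := length_le_of_mem_covered hfun
        (List.nodup_cons.2 ⟨(Finset.mem_filter.1 hw).2, h₂⟩) hx
      simp only [List.length_cons] at this
      omega
    rw [hsum, add_zero] at hcard
    rw [← heq]
    exact h₃.trans (Nat.mul_le_mul_right _ hcard)

end Selection

theorem Partrec.exists_primrec_stages {U : Str × Str →. Str} (hU : Partrec U) :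
    ∃ V : ℕ → Str → Str → Option Str,
      (Primrec fun q : ℕ × Str × Str => V q.1 q.2.1 q.2.2) ∧
      (∀ s t p y z, s ≤ t → V s p y = some z → V t p y = some z) ∧
      ∀ p y z, z ∈ U (p, y) ↔ ∃ t, V t p y = some z := by
  obtain ⟨c, hc⟩ := Nat.Partrec.Code.exists_code.1 hU
  refine ⟨fun t p y => (Nat.Partrec.Code.evaln t c (Encodable.encode (p, y))).bind
    Encodable.decode, ?_, ?_, ?_⟩
  · exact Primrec.option_bind
      (Nat.Partrec.Code.primrec_evaln.comp ((Primrec.fst.pair (Primrec.const c)).pair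
        (Primrec.encode.comp Primrec.snd)))
      (Primrec.decode.comp Primrec.snd).to₂
  · intro s t p y z hst h
    rw [Option.bind_eq_some_iff] at h ⊢
    obtain ⟨a, ha, haz⟩ := h
    exact ⟨a, Nat.Partrec.Code.evaln_mono hst ha, haz⟩
  · intro p y z
    have h : ∀ a, a ∈ Nat.Partrec.Code.eval c (Encodable.encode (p, y)) ↔
        ∃ z ∈ U (p, y), Encodable.encode z = a := by
      intro a
      rw [hc]
      simp
    constructor
    · intro hz
      obtain ⟨t, ht⟩ := Nat.Partrec.Code.evaln_complete.1 ((h _).2 ⟨z, hz, rfl⟩)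
      exact ⟨t, Option.bind_eq_some_iff.2 ⟨_, ht, Encodable.encodek z⟩⟩
    · rintro ⟨t, ht⟩
      obtain ⟨a, ha, haz⟩ := Option.bind_eq_some_iff.1 ht
      obtain ⟨z', hz', rfl⟩ := (h a).1 (Nat.Partrec.Code.evaln_sound ha)
      rw [Encodable.encodek, Option.some.injEq] at haz
      exact haz ▸ hz'

theorem UniversalM.exists_program {U : Str × Str →. Str} (hU : UniversalM U) (x y : Str) :
    ∃ p : Str, p.length = KC U x y ∧ x ∈ U (p, y) := by
  obtain ⟨c, hc⟩ := hU.2 (fun q => Part.some q.1) Computable.fst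
  obtain ⟨q, hq, -⟩ := hc x y x (Part.mem_some x)
  exact Nat.sInf_mem (s := {l : ℕ | ∃ p : Str, p.length = l ∧ x ∈ U (p, y)})
    ⟨q.length, q, rfl, hq⟩

theorem KC_le_length {U : Str × Str →. Str} {x y p : Str} (h : x ∈ U (p, y)) :
    KC U x y ≤ p.length :=
  Nat.sInf_le ⟨p, rfl, h⟩

/-- Fewer than `2 ^ (s + 1)` strings have complexity at most `s`. -/
theorem UniversalM.card_lt_of_KC0_le {U : Str × Str →. Str} (hU : UniversalM U) {s : ℕ}
    {G : Finset Str} (hG : ∀ x ∈ G, KC0 U x ≤ s) : G.card < 2 ^ (s + 1) := by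
  choose f hf hfU using fun x => hU.exists_program x []
  have h : G.card ≤ (strsLE s).toFinset.card := by
    refine Finset.card_le_card_of_injOn f ?_ ?_
    · intro x hx
      simpa [mem_strsLE, hf, KC0] using hG x hx
    · intro x _ y _ hxy
      have hx := hfU x
      rw [hxy] at hx
      exact Part.mem_unique hx (hfU y)
  have h₁ := (strsLE s).toFinset_card_le
  rw [length_strsLE] at h₁
  have : 0 < 2 ^ (s + 1) := by positivity
  omega

/-- A set of strings containing a `(2 ^ m' + 1) ^ (-K)` fraction of the strings of length `n`
contains a string of complexity more than `n - K * logb 2 (2 ^ (m' + 1) + 1)`. -/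
theorem UniversalM.exists_lt_KC0 {U : Str × Str →. Str} (hU : UniversalM U) {n m' K : ℕ}
    (hm : 1 ≤ m') (hK : 2 ≤ K) {G : Finset Str}
    (hG : 2 ^ n ≤ G.card * (2 ^ m' + 1) ^ K) :
    ∃ x ∈ G, (n : ℝ) - K * Real.logb 2 (2 ^ (m' + 1) + 1) < (KC0 U x : ℝ) := by
  by_contra! h
  set L : ℝ := (n : ℝ) - K * Real.logb 2 (2 ^ (m' + 1) + 1) with hL
  have hne : G.Nonempty := by
    rw [← Finset.card_pos]
    by_contra h0
    simp only [not_lt, Nat.le_zero] at h0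
    rw [h0, zero_mul] at hG
    have : 0 < 2 ^ n := by positivity
    omega
  obtain ⟨x₀, hx₀⟩ := hne
  have hL₀ : 0 ≤ L := (Nat.cast_nonneg _).trans (h x₀ hx₀)
  have hcard := hU.card_lt_of_KC0_le fun x hx => Nat.le_floor (h x hx)
  have hpow : (2 : ℝ) ^ ⌊L⌋₊ * (2 ^ (m' + 1) + 1) ^ K ≤ 2 ^ n := by
    have e : (2 : ℝ) ^ L * (2 ^ (m' + 1) + 1) ^ K = 2 ^ n := by
      have hb : (0 : ℝ) < 2 ^ (m' + 1) + 1 := by positivity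
      rw [hL, Real.rpow_sub (by norm_num), mul_comm (K : ℝ), Real.rpow_mul (by norm_num),
        Real.rpow_logb (by norm_num) (by norm_num) hb, Real.rpow_natCast, Real.rpow_natCast]
      field_simp
    rw [← e, ← Real.rpow_natCast]
    gcongr
    · norm_num
    · exact Nat.floor_le hL₀
  have hpow' : 2 ^ ⌊L⌋₊ * (2 ^ (m' + 1) + 1) ^ K ≤ 2 ^ n := by exact_mod_cast hpow
  have hgain : 2 * (2 ^ m' + 1) ^ K ≤ (2 ^ (m' + 1) + 1) ^ K := by
    have h₁ : 5 * (2 ^ m' + 1) ≤ 3 * (2 ^ (m' + 1) + 1) := by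
      have : 2 ^ 1 ≤ 2 ^ m' := Nat.pow_le_pow_right (by norm_num) hm
      rw [pow_succ]
      omega
    have h₂ := Nat.pow_le_pow_left h₁ K
    rw [mul_pow, mul_pow] at h₂
    have h₃ : 2 * 3 ^ K ≤ 5 ^ K := by
      obtain ⟨i, rfl⟩ := Nat.exists_eq_add_of_le hK
      have : 3 ^ i ≤ 5 ^ i := Nat.pow_le_pow_left (by norm_num) i
      rw [pow_add, pow_add]
      omega
    have h₄ : 0 < 3 ^ K := by positivity
    refine Nat.le_of_mul_le_mul_left ?_ h₄
    calc 3 ^ K * (2 * (2 ^ m' + 1) ^ K) = 2 * 3 ^ K * (2 ^ m' + 1) ^ K := by ring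
      _ ≤ 5 ^ K * (2 ^ m' + 1) ^ K := Nat.mul_le_mul_right _ h₃
      _ ≤ _ := h₂
  have hpos : 0 < (2 ^ (m' + 1) + 1) ^ K := by positivity
  have e₁ := Nat.mul_lt_mul_of_pos_right hcard hpos
  have e₂ := Nat.mul_le_mul_left G.card hgain
  rw [pow_succ 2 ⌊L⌋₊] at e₁
  nlinarith

/-- The arguments of `chain` described by a program that consists of self-delimiting `n` and
`m'`, a bit, and a string `s` whose length determines `k` and whose position determines the
number of a chain element. -/
def chainArgs (p : Str) : (List Str × List Str × List Str) × ℕ :=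
  let a := readNat p
  let b := readNat a.2
  ((strs a.1, strs b.1, strsLE (b.2.tail.length - 1)), strVal b.2.tail + 1)

theorem primrec_chainArgs : Primrec chainArgs := by
  have hb : Primrec fun p => readNat (readNat p).2 :=
    primrec_readNat.comp (Primrec.snd.comp primrec_readNat)
  have hs : Primrec fun p => (readNat (readNat p).2).2.tail :=
    Primrec.list_tail.comp (Primrec.snd.comp hb)
  have hX : Primrec fun p => strs (readNat p).1 :=
    primrec_strs.comp (Primrec.fst.comp primrec_readNat)
  have hW : Primrec fun p => strs (readNat (readNat p).2).1 :=
    primrec_strs.comp (Primrec.fst.comp hb)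
  have hP : Primrec fun p => strsLE ((readNat (readNat p).2).2.tail.length - 1) :=
    primrec_strsLE.comp (Primrec.pred.comp (Primrec.list_length.comp hs))
  have hj : Primrec fun p => strVal (readNat (readNat p).2).2.tail + 1 :=
    Primrec.succ.comp (primrec_strVal.comp hs)
  exact (hX.pair (hW.pair hP)).pair hj

/-- The bit stored in a program that starts with two self-delimiting numbers. -/
def leadBit (p : Str) : Bool := (readNat (readNat p).2).2.headI

theorem primrec_leadBit : Primrec leadBit :=
  Primrec.list_headI.comp
    (Primrec.snd.comp (primrec_readNat.comp (Primrec.snd.comp primrec_readNat)))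

/-- The machine that outputs the bit stored in its program followed by the last chain element
for the arguments described by the program. -/
noncomputable def chainMachine (R : ℕ → Str → Str → Str → Prop) (q : Str × Str) : Part Str :=
  (chain R (chainArgs q.1).1.1 (chainArgs q.1).1.2.1 (chainArgs q.1).1.2.2 (chainArgs q.1).2).map
    fun l => leadBit q.1 :: l.headI

theorem partrec_chainMachine {R : ℕ → Str → Str → Str → Prop}
    (hR : PrimrecPred fun q : ℕ × Str × Str × Str => R q.1 q.2.1 q.2.2.1 q.2.2.2) :
    Partrec (chainMachine R) := by
  have h₁ : Computable fun q : Str × Str => chainArgs q.1 :=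
    (primrec_chainArgs.comp Primrec.fst).to_comp
  have h₂ : Computable₂ fun (q : Str × Str) (l : List Str) => leadBit q.1 :: l.headI :=
    (Primrec.list_cons.comp (primrec_leadBit.comp (Primrec.fst.comp Primrec.fst))
      (Primrec.list_headI.comp Primrec.snd)).to_comp
  exact ((partrec_chain hR).comp h₁).map h₂

theorem mem_chainMachine {R : ℕ → Str → Str → Str → Prop} {n m' k i : ℕ} {w : Str}
    {ls : List Str} {b : Bool} (y : Str) (hi : i < 2 ^ (k + 1))
    (h : w :: ls ∈ chain R (strs n) (strs m') (strsLE k) (i + 1)) :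
    b :: w ∈ chainMachine R
      (selfDelim n ++ (selfDelim m' ++ b :: strRep (k + 1) i), y) := by
  simp only [chainMachine, chainArgs, leadBit, readNat_selfDelim, List.tail_cons,
    length_strRep hi, strVal_strRep hi, Nat.add_sub_cancel, Part.mem_map_iff]
  exact ⟨_, h, rfl⟩

/-- There is a constant `c` (depending only on the universal machine)
such that for all integers `n, m, k ≥ 2`, with `K = 2^{k+1} − 1`, there is a string
`x ∈ {0,1}^n` with `C(x) > n − K·log₂(2^m + 1)` such that every `z ∈ {0,1}^m` with
`C(z|x) ≤ k` has `C(z) ≤ k + log₂ n + log₂ m + c·(log₂ log₂ n + log₂ log₂ m) + c`. -/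
theorem stmt2 (U : Str × Str →. Str) (hU : UniversalM U) :
    ∃ c : ℝ, ∀ n m k : ℕ, 2 ≤ n → 2 ≤ m → 2 ≤ k →
      ∃ x : Str, x.length = n ∧
        (n : ℝ) - (2 ^ (k + 1) - 1 : ℕ) * Real.logb 2 (2 ^ m + 1) < (KC0 U x : ℝ) ∧
        ∀ z : Str, z.length = m → KC U z x ≤ k →
          (KC0 U z : ℝ) ≤ (k : ℝ) + Real.logb 2 n + Real.logb 2 m +
            c * (Real.logb 2 (Real.logb 2 n) + Real.logb 2 (Real.logb 2 m)) + c := by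
  classical
  obtain ⟨V, hV, hVmono, hVU⟩ := hU.1.exists_primrec_stages
  let R : ℕ → Str → Str → Str → Prop := fun t p x w =>
    V t p x = some (false :: w) ∨ V t p x = some (true :: w)
  have hR : PrimrecPred fun q : ℕ × Str × Str × Str => R q.1 q.2.1 q.2.2.1 q.2.2.2 := by
    have h₁ := hV.comp (Primrec.fst.pair ((Primrec.fst.comp Primrec.snd).pair
      (Primrec.fst.comp (Primrec.snd.comp (Primrec.snd (α := ℕ) (β := Str × Str × Str))))))
    have h₂ : ∀ b : Bool, Primrec fun q : ℕ × Str × Str × Str => some (b :: q.2.2.2) := fun b =>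
      Primrec.option_some.comp (Primrec.list_cons.comp (Primrec.const b)
        (Primrec.snd.comp (Primrec.snd.comp Primrec.snd)))
    exact (Primrec.eq.comp h₁ (h₂ false)).or (Primrec.eq.comp h₁ (h₂ true))
  have hmono : ∀ s t p x v, s ≤ t → R s p x v → R t p x v := fun s t p x v hst h =>
    h.imp (hVmono _ _ _ _ _ hst) (hVmono _ _ _ _ _ hst)
  have hfun : ∀ s t p x v w, R s p x v → R t p x w → v = w := by
    intro s t p x v w h₁ h₂
    have h₁' := h₁.imp (hVmono _ _ _ _ _ (le_max_left s t)) (hVmono _ _ _ _ _ (le_max_left s t))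
    have h₂' := h₂.imp (hVmono _ _ _ _ _ (le_max_right s t)) (hVmono _ _ _ _ _ (le_max_right s t))
    rcases h₁' with h₁' | h₁' <;> rcases h₂' with h₂' | h₂' <;>
      simp_all
  obtain ⟨cU, hcU⟩ := hU.2 (chainMachine R) (partrec_chainMachine hR)
  refine ⟨cU + 14, fun n m k hn hm hk => ?_⟩
  obtain ⟨m', rfl⟩ : ∃ m', m = m' + 1 := ⟨m - 1, by omega⟩
  obtain ⟨l, hl, hlarge⟩ := exists_chain_large hmono hfun (X := strs n) (W := strs m')
    (P := strsLE k) (nodup_strs n) (List.ne_nil_of_length_pos (by rw [length_strs]; positivity))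
  simp only [length_strs, length_strsLE] at hl hlarge
  have hK : 2 ≤ 2 ^ (k + 1) - 1 := by
    have : 2 ^ 3 ≤ 2 ^ (k + 1) := Nat.pow_le_pow_right (by norm_num) (by omega)
    omega
  obtain ⟨x, hx, hxC⟩ := hU.exists_lt_KC0 (by omega) hK hlarge
  simp only [Finset.mem_filter, List.mem_toFinset, mem_strs] at hx
  refine ⟨x, hx.1, hxC, fun z hz hzk => ?_⟩
  rcases z with _ | ⟨b, w⟩
  · simp at hz
  have hw : w.length = m' := by simpa using hz
  have hhit : Hits R (strsLE k) x w := by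
    obtain ⟨p, hp, hpU⟩ := hU.exists_program (b :: w) x
    obtain ⟨t, ht⟩ := (hVU _ _ _).1 hpU
    refine ⟨p, mem_strsLE.2 (hp ▸ hzk), t, ?_⟩
    cases b
    · exact Or.inl ht
    · exact Or.inr ht
  obtain ⟨i, hi, ls, hls⟩ := hl w (hx.2 w hw hhit)
  have hi' : i < 2 ^ (k + 1) := by omega
  obtain ⟨q, hq, hqlen⟩ := hcU _ _ _ (mem_chainMachine (b := b) [] hi' hls)
  have h₁ : KC0 U (b :: w) ≤ (selfDelim n).length + (selfDelim (m' + 1)).length + (k + 2) + cU := by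
    refine (KC_le_length hq).trans (hqlen.trans ?_)
    have := length_selfDelim_mono (Nat.le_succ m')
    simp only [List.length_append, List.length_cons, length_strRep hi', Nat.succ_eq_add_one]
      at this ⊢
    omega
  have h₂ : (KC0 U (b :: w) : ℝ) ≤
      (selfDelim n).length + (selfDelim (m' + 1)).length + (k + 2) + cU := by exact_mod_cast h₁
  have hn₁ := length_selfDelim_le hn
  have hm₁ := length_selfDelim_le hm
  have hn₂ := logb_logb_two_nonneg hn
  have hm₂ := logb_logb_two_nonneg hm
  have hc : (0 : ℝ) ≤ cU := Nat.cast_nonneg _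
  nlinarith [mul_nonneg hc hn₂, mul_nonneg hc hm₂]
end

section
/- Let D be a probability distribution over {0,1}^n, let K be a positive integer with K ≤ 2^n, and let ε > 0. Suppose that for every set S ⊆ {0,1}^n of size K, D(S) ≤ ε. Then D is ε-close to some distribution over {0,1}^n with min-entropy at least log₂(K/ε). -/
/-- The finite set of all binary strings of length `n`. -/
def strFinset (n : ℕ) : Finset Str :=
  (Finset.univ : Finset (Fin n → Bool)).image List.ofFn

/-- `D` is a probability distribution over `{0,1}^n`. -/
def IsDistOn (n : ℕ) (D : Str → ℝ) : Prop :=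
  (∀ x, 0 ≤ D x) ∧ (∀ x, D x ≠ 0 → x.length = n) ∧ (∑ x ∈ strFinset n, D x) = 1

/-- The min-entropy of `D` is at least `s`, i.e. every point has mass at most `2^{-s}`. -/
def minEntropyGe (D : Str → ℝ) (s : ℝ) : Prop := ∀ x, D x ≤ (2 : ℝ) ^ (-s)

/-- `X` and `Y` are `ε`-close in statistical distance. -/
def closeDist (X Y : Str → ℝ) (ε : ℝ) : Prop :=
  ∀ A : Finset Str, |(∑ a ∈ A, X a) - (∑ a ∈ A, Y a)| ≤ ε

theorem mem_strFinset {n : ℕ} {x : Str} : x ∈ strFinset n ↔ x.length = n := by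
  simp only [strFinset, Finset.mem_image, Finset.mem_univ, true_and]
  constructor
  · rintro ⟨f, rfl⟩
    exact List.length_ofFn
  · rintro rfl
    exact ⟨x.get, List.ofFn_get x⟩

theorem card_strFinset (n : ℕ) : (strFinset n).card = 2 ^ n := by
  rw [strFinset, Finset.card_image_of_injective _ List.ofFn_injective]
  simp

/-- If all `K`-subsets of `s` have mass at most `K * c`, then one of them contains every point
of mass more than `c`. -/
theorem exists_subset_card_eq_forall_le {α : Type*} [DecidableEq α] (s : Finset α) (K : ℕ)
    (hK : 0 < K) (hKs : K ≤ s.card) (f : α → ℝ) (c : ℝ)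
    (hS : ∀ S ⊆ s, S.card = K → ∑ a ∈ S, f a ≤ K * c) :
    ∃ S ⊆ s, S.card = K ∧ ∀ a ∈ s, a ∉ S → f a ≤ c := by
  have hH : (s.filter (fun a => c < f a)).card ≤ K := by
    by_contra! h
    obtain ⟨T, hT, hTK⟩ := Finset.exists_subset_card_eq h.le
    have h1 := hS T (hT.trans (Finset.filter_subset _ _)) hTK
    have h2 : ∑ _a ∈ T, c < ∑ a ∈ T, f a :=
      Finset.sum_lt_sum_of_nonempty (Finset.card_pos.mp (hTK ▸ hK))
        fun a ha => (Finset.mem_filter.mp (hT ha)).2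
    rw [Finset.sum_const, hTK, nsmul_eq_mul] at h2
    linarith
  obtain ⟨S, hHS, hSs, hSK⟩ :=
    Finset.exists_subsuperset_card_eq (Finset.filter_subset _ _) hH hKs
  refine ⟨S, hSs, hSK, fun a ha haS => ?_⟩
  by_contra! h
  exact haS (hHS (Finset.mem_filter.mpr ⟨ha, h⟩))

/-- A nonnegative function of total mass at most `s.card * c` can be flattened to one bounded
by `c` by moving only its excess mass over `c`. -/
theorem exists_flattening {α : Type*} (s : Finset α) (f : α → ℝ) (c : ℝ) (hc : 0 ≤ c)
    (hf : ∀ a, 0 ≤ f a) (hsum : ∑ a ∈ s, f a ≤ s.card * c) :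
    ∃ g : α → ℝ, (∀ a, 0 ≤ g a) ∧ (∀ a, g a ≤ c) ∧ ∑ a ∈ s, g a = ∑ a ∈ s, f a ∧
      ∀ A ⊆ s, |∑ a ∈ A, f a - ∑ a ∈ A, g a| ≤ ∑ a ∈ s, max (f a - c) 0 := by
  set E := ∑ a ∈ s, max (f a - c) 0 with hE
  set F := ∑ a ∈ s, max (c - f a) 0 with hF
  have hE0 : 0 ≤ E := Finset.sum_nonneg fun _ _ => le_max_right _ _
  have hF0 : 0 ≤ F := Finset.sum_nonneg fun _ _ => le_max_right _ _
  have hFE : F - E = s.card * c - ∑ a ∈ s, f a := by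
    rw [hE, hF, ← Finset.sum_sub_distrib, ← nsmul_eq_mul, ← Finset.sum_const,
      ← Finset.sum_sub_distrib]
    refine Finset.sum_congr rfl fun a _ => ?_
    rcases le_total (f a) c with h | h
    · rw [max_eq_left (by linarith), max_eq_right (by linarith)]; ring
    · rw [max_eq_right (by linarith), max_eq_left (by linarith)]; ring
  have hEF : E ≤ F := by linarith
  obtain ⟨t, ht0, ht1, htF⟩ : ∃ t : ℝ, 0 ≤ t ∧ t ≤ 1 ∧ t * F = E := by
    refine ⟨E / F, by positivity, div_le_one_of_le₀ hEF hF0, ?_⟩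
    rcases hF0.eq_or_lt with h | h
    · rw [← h]; linarith
    · field_simp
  have hdiff : ∀ A : Finset α,
      ∑ a ∈ A, f a - ∑ a ∈ A, (f a - max (f a - c) 0 + t * max (c - f a) 0) =
        ∑ a ∈ A, max (f a - c) 0 - t * ∑ a ∈ A, max (c - f a) 0 := by
    intro A
    rw [Finset.sum_add_distrib, Finset.sum_sub_distrib, Finset.mul_sum]
    ring
  refine ⟨fun a => f a - max (f a - c) 0 + t * max (c - f a) 0, fun a => ?_, fun a => ?_, ?_,
    fun A hA => ?_⟩
  · have h1 : max (f a - c) 0 ≤ f a := max_le (by linarith) (hf a)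
    have h2 : 0 ≤ t * max (c - f a) 0 := mul_nonneg ht0 (le_max_right _ _)
    linarith
  · have h2 : t * max (c - f a) 0 ≤ max (c - f a) 0 :=
      mul_le_of_le_one_left (le_max_right _ _) ht1
    dsimp only
    rcases le_total (f a) c with h | h
    · rw [max_eq_left (by linarith : 0 ≤ c - f a)] at h2
      have := le_max_right (f a - c) 0
      rw [max_eq_left (by linarith : 0 ≤ c - f a)]
      linarith
    · rw [max_eq_right (by linarith : c - f a ≤ 0)]
      have := le_max_left (f a - c) 0
      linarith
  · have := hdiff s
    rw [← hE, ← hF, htF] at this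
    linarith
  · rw [hdiff A]
    have h1 : ∑ a ∈ A, max (f a - c) 0 ≤ E :=
      Finset.sum_le_sum_of_subset_of_nonneg hA fun _ _ _ => le_max_right _ _
    have h2 : t * ∑ a ∈ A, max (c - f a) 0 ≤ t * F :=
      mul_le_mul_of_nonneg_left
        (Finset.sum_le_sum_of_subset_of_nonneg hA fun _ _ _ => le_max_right _ _) ht0
    have h3 : 0 ≤ ∑ a ∈ A, max (f a - c) 0 := Finset.sum_nonneg fun _ _ => le_max_right _ _
    have h4 : 0 ≤ t * ∑ a ∈ A, max (c - f a) 0 :=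
      mul_nonneg ht0 (Finset.sum_nonneg fun _ _ => le_max_right _ _)
    rw [abs_le]
    constructor <;> linarith

/-- if every set of size `K` has mass at most `ε` under `D`, then `D` is
`ε`-close to a distribution with min-entropy at least `log₂(K/ε)`. -/
theorem stmt5 (n K : ℕ) (hK : 0 < K) (hKn : K ≤ 2 ^ n) (ε : ℝ) (hε : 0 < ε)
    (D : Str → ℝ) (hD : IsDistOn n D)
    (hS : ∀ S : Finset Str, S ⊆ strFinset n → S.card = K → ∑ a ∈ S, D a ≤ ε) :
    ∃ D' : Str → ℝ, IsDistOn n D' ∧ minEntropyGe D' (Real.logb 2 ((K : ℝ) / ε)) ∧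
      closeDist D D' ε := by
  obtain ⟨hD0, hDn, hD1⟩ := hD
  have hK' : (0 : ℝ) < K := Nat.cast_pos.mpr hK
  set c := ε / K with hc
  have hc0 : 0 < c := by positivity
  have hKc : K * c = ε := by rw [hc]; field_simp
  have hpow : (2 : ℝ) ^ (-Real.logb 2 ((K : ℝ) / ε)) = c := by
    rw [Real.rpow_neg (by norm_num), Real.rpow_logb (by norm_num) (by norm_num) (by positivity),
      inv_div]
  obtain ⟨S, hSs, hSK, hSc⟩ := exists_subset_card_eq_forall_le (strFinset n) K hK
    (by rwa [card_strFinset]) D c (fun S h1 h2 => (hS S h1 h2).trans_eq hKc.symm)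
  have hSε := hS S hSs hSK
  have hsum : ∑ a ∈ strFinset n, D a ≤ (strFinset n).card * c := by
    have h1 : ∑ a ∈ strFinset n \ S, D a ≤ (strFinset n \ S).card * c := by
      rw [← nsmul_eq_mul]
      refine Finset.sum_le_card_nsmul _ _ _ fun a ha => ?_
      rw [Finset.mem_sdiff] at ha
      exact hSc a ha.1 ha.2
    have h2 : ((strFinset n \ S).card : ℝ) + K = (strFinset n).card := by
      rw [← hSK]
      exact_mod_cast Finset.card_sdiff_add_card_eq_card hSs
    rw [← Finset.sum_sdiff hSs, ← h2, add_mul, hKc]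
    linarith
  have hexcess : ∑ a ∈ strFinset n, max (D a - c) 0 ≤ ε := by
    rw [← Finset.sum_subset hSs fun a ha haS =>
      max_eq_right (sub_nonpos.mpr (hSc a ha haS))]
    exact (Finset.sum_le_sum fun a _ => max_le (by linarith) (hD0 a)).trans hSε
  obtain ⟨g, hg0, hgc, hgsum, hgclose⟩ :=
    exists_flattening (strFinset n) D c hc0.le hD0 hsum
  refine ⟨fun x => if x ∈ strFinset n then g x else 0, ⟨fun x => ?_, fun x hx => ?_, ?_⟩,
    fun x => ?_, fun A => ?_⟩
  · dsimp only
    split_ifs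
    exacts [hg0 x, le_rfl]
  · by_contra h
    exact hx (if_neg (mt mem_strFinset.mp h))
  · rw [Finset.sum_congr rfl fun x hx => if_pos hx, hgsum, hD1]
  · rw [hpow]
    dsimp only
    split_ifs
    exacts [hgc x, hc0.le]
  · have hDA : ∑ a ∈ A, D a = ∑ a ∈ A with a ∈ strFinset n, D a := by
      refine (Finset.sum_filter_of_ne fun a _ ha => ?_).symm
      exact mem_strFinset.mpr (hDn a ha)
    rw [hDA, ← Finset.sum_filter]
    exact (hgclose _ fun a ha => (Finset.mem_filter.mp ha).2).trans hexcess
end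

section
/- For every infinite binary sequence x, the effective Hausdorff dimension of x equals liminf_{n→∞} K(x↾n)/n, where K is prefix-free Kolmogorov complexity; that is, inf{s ∈ ℚ, s ≥ 0 : there exists a computably enumerable set C ⊆ {0,1}^* with Σ_{σ∈C} 2^{−s|σ|} < ∞ such that infinitely many prefixes of x belong to C} = liminf_{n→∞} K(x↾n)/n. -/
/-- `V` is an optimal universal prefix-free machine: it is partial computable with
prefix-free domain and simulates every prefix-free partial computable machine with
constant-length overhead. -/
def PrefixFreeUniversal (V : Str →. Str) : Prop :=
  Partrec V ∧ (∀ p q : Str, (V p).Dom → (V q).Dom → p <+: q → p = q) ∧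
    ∀ M : Str →. Str, Partrec M →
      (∀ p q : Str, (M p).Dom → (M q).Dom → p <+: q → p = q) →
      ∃ c : ℕ, ∀ σ p : Str, σ ∈ M p → ∃ q : Str, σ ∈ V q ∧ q.length ≤ p.length + c

/-- Prefix-free Kolmogorov complexity with respect to `V`. -/
noncomputable def Kpf (V : Str →. Str) (σ : Str) : ℕ :=
  sInf {l : ℕ | ∃ p : Str, p.length = l ∧ σ ∈ V p}

/-- A set of strings is computably enumerable if it is the range of a partial
computable function. -/
def CE (S : Set Str) : Prop :=
  ∃ g : ℕ →. Str, Partrec g ∧ ∀ σ, σ ∈ S ↔ ∃ n, σ ∈ g n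

/-- The length-`n` prefix of an infinite binary sequence. -/
def pre (x : ℕ → Bool) (n : ℕ) : Str := List.ofFn (fun i : Fin n => x i)

/-- A domain is prefix-free when no element is a proper prefix of another. -/
def PrefixFreeOn (S : Set Str) : Prop :=
  ∀ p ∈ S, ∀ q ∈ S, p <+: q → p = q

lemma uniquelyDecodable_of_prefixFreeOn {S : Set Str} (hS : PrefixFreeOn S) (hnil : [] ∉ S) :
    InformationTheory.UniquelyDecodable S := by
  intro L₁
  induction L₁ with
  | nil =>
    intro L₂ _ h₂ h
    cases L₂ with
    | nil => rfl
    | cons v L₂ =>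
      have hv : v = [] := (List.append_eq_nil_iff.1 h.symm).1
      exact absurd (hv ▸ h₂ v (by simp)) hnil
  | cons u L₁ ih =>
    intro L₂ h₁ h₂ h
    cases L₂ with
    | nil =>
      have hu : u = [] := (List.append_eq_nil_iff.1 h).1
      exact absurd (hu ▸ h₁ u (by simp)) hnil
    | cons v L₂ =>
      have hu := h₁ u (by simp)
      have hv := h₂ v (by simp)
      simp only [List.flatten_cons] at h
      have huv : u = v := by
        rcases List.prefix_or_prefix_of_prefix (List.prefix_append u L₁.flatten)
          (h ▸ List.prefix_append v L₂.flatten) with h' | h'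
        · exact hS u hu v hv h'
        · exact (hS v hv u hu h').symm
      subst huv
      rw [ih L₂ (fun w hw => h₁ w (by simp [hw])) (fun w hw => h₂ w (by simp [hw]))
        (List.append_cancel_left h)]

/-- Kraft's inequality for finite prefix-free sets of binary strings. -/
lemma kraft_of_prefixFreeOn {F : Finset Str} (hF : PrefixFreeOn (F : Set Str)) :
    ∑ p ∈ F, ((1 : ℝ) / 2) ^ p.length ≤ 1 := by
  by_cases hnil : [] ∈ F
  · have : F = {[]} := by
      refine Finset.eq_singleton_iff_unique_mem.2 ⟨hnil, fun q hq => ?_⟩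
      exact (hF [] hnil q hq (List.nil_prefix)).symm
    simp [this]
  · simpa using InformationTheory.kraft_mcmillan_inequality
      (uniquelyDecodable_of_prefixFreeOn hF (by simpa using hnil))

/-- Every computably enumerable set has a total computable enumeration with pauses. -/
lemma CE.exists_enum {S : Set Str} (hS : CE S) :
    ∃ e : ℕ → Option Str, Primrec e ∧ ∀ σ, σ ∈ S ↔ ∃ k, e k = some σ := by
  obtain ⟨g, hg, hgS⟩ := hS
  obtain ⟨c, hc⟩ := Nat.Partrec.Code.exists_code.1 (Partrec.nat_iff.1 (Partrec.map_encode_iff.2 hg))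
  refine ⟨fun k => (Nat.Partrec.Code.evaln k.unpair.1 c k.unpair.2).bind Encodable.decode, ?_, ?_⟩
  · refine Primrec.option_bind (Nat.Partrec.Code.primrec_evaln.comp
      (((Primrec.fst.comp Primrec.unpair).pair (Primrec.const c)).pair
        (Primrec.snd.comp Primrec.unpair))) ?_
    exact Primrec.decode.comp Primrec.snd
  · intro σ
    rw [hgS]
    constructor
    · rintro ⟨n, hn⟩
      have : Encodable.encode σ ∈ c.eval n := by
        rw [hc]; exact Part.mem_map _ hn
      obtain ⟨t, ht⟩ := Nat.Partrec.Code.evaln_complete.1 this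
      refine ⟨Nat.pair t n, ?_⟩
      simp only [Nat.unpair_pair]
      rw [Option.mem_def.1 ht]
      simp
    · rintro ⟨k, hk⟩
      obtain ⟨m, hm, hσ⟩ := Option.bind_eq_some_iff.1 hk
      have := Nat.Partrec.Code.evaln_sound (Option.mem_def.2 hm)
      rw [hc] at this
      obtain ⟨τ, hτ, rfl⟩ := (Part.mem_map_iff _).1 this
      rw [Encodable.encodek] at hσ
      exact ⟨_, Option.some.inj hσ ▸ hτ⟩

/-- The strings of length `n` among the first `k` values of `e`, without repetition,
in order of first appearance. -/
def enumList (e : ℕ → Option Str) (n k : ℕ) : List Str :=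
  k.rec [] fun j L => (e j).elim L fun σ =>
    if σ.length = n ∧ σ ∉ L then L ++ [σ] else L

lemma enumList_succ (e : ℕ → Option Str) (n k : ℕ) :
    enumList e n (k + 1) = (e k).elim (enumList e n k) fun σ =>
      if σ.length = n ∧ σ ∉ enumList e n k
      then enumList e n k ++ [σ] else enumList e n k := rfl

lemma primrec_enumList {e : ℕ → Option Str} (he : Primrec e) : Primrec₂ (enumList e) := by
  refine Primrec.nat_rec (f := fun _ : ℕ => ([] : List Str))
    (g := fun n jL => (e jL.1).elim jL.2 fun σ =>
      if σ.length = n ∧ σ ∉ jL.2 then jL.2 ++ [σ] else jL.2)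
    (Primrec.const []) ?_
  refine Primrec.of_eq (f := fun a : ℕ × ℕ × List Str => Option.casesOn (e a.2.1) a.2.2 fun σ =>
      if σ.length = a.1 ∧ σ ∉ a.2.2 then a.2.2 ++ [σ] else a.2.2) ?_ ?_
  · refine Primrec.option_casesOn (he.comp (Primrec.fst.comp Primrec.snd))
      (Primrec.snd.comp Primrec.snd) ?_
    have hL : Primrec fun p : (ℕ × ℕ × List Str) × Str => p.1.2.2 :=
      Primrec.snd.comp (Primrec.snd.comp Primrec.fst)
    refine Primrec.ite (PrimrecPred.and ?_ ?_) ?_ hL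
    · exact Primrec.eq.comp (Primrec.list_length.comp Primrec.snd) (Primrec.fst.comp Primrec.fst)
    · have hmem : PrimrecRel fun (L : List Str) σ => ∃ τ ∈ L, τ = σ :=
        PrimrecRel.exists_mem_list Primrec.eq
      exact (PrimrecRel.comp hmem hL Primrec.snd).not.of_eq fun p => by simp
    · exact Primrec.list_concat.comp hL Primrec.snd
  · intro a
    cases h : e a.2.1 <;> simp [h]

lemma enumList_prefix (e : ℕ → Option Str) (n : ℕ) {k l : ℕ} (h : k ≤ l) :
    enumList e n k <+: enumList e n l := by
  induction l, h using Nat.le_induction with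
  | base => exact List.prefix_rfl
  | succ l _ ih =>
    refine ih.trans ?_
    rw [enumList_succ]
    cases e l with
    | none => exact List.prefix_rfl
    | some σ =>
      simp only [Option.elim_some]
      split_ifs
      · exact List.prefix_append _ _
      · exact List.prefix_rfl

lemma enumList_nodup (e : ℕ → Option Str) (n k : ℕ) : (enumList e n k).Nodup := by
  induction k with
  | zero => exact List.nodup_nil
  | succ k ih =>
    rw [enumList_succ]
    cases e k with
    | none => exact ih
    | some σ =>
      simp only [Option.elim_some]
      split_ifs with h
      · rw [← List.concat_eq_append]
        exact ih.concat h.2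
      · exact ih

lemma mem_enumList {e : ℕ → Option Str} {n k : ℕ} {σ : Str} (h : σ ∈ enumList e n k) :
    σ.length = n ∧ ∃ j, e j = some σ := by
  induction k with
  | zero => simp [enumList] at h
  | succ k ih =>
    rw [enumList_succ] at h
    cases hk : e k with
    | none => rw [hk] at h; exact ih h
    | some τ =>
      rw [hk] at h
      simp only [Option.elim_some] at h
      split_ifs at h with h'
      · rcases List.mem_append.1 h with h | h
        · exact ih h
        · rw [List.mem_singleton.1 h]
          exact ⟨h'.1, k, hk⟩
      · exact ih h

lemma mem_enumList_succ {e : ℕ → Option Str} {k : ℕ} {σ : Str} (h : e k = some σ) :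
    σ ∈ enumList e σ.length (k + 1) := by
  rw [enumList_succ, h]
  simp only [Option.elim_some, true_and]
  split_ifs with h'
  · exact h'
  · simp

/-- A prefix code for pairs `(n, i)` with `i < 2 ^ w n`: the two components of `Nat.unpair n` in
unary, followed by the `w n` binary digits of `i`. -/
def codeWord (w : ℕ → ℕ) (n i : ℕ) : Str :=
  ((List.range n.unpair.1).map fun _ => true) ++ (false ::
    (((List.range n.unpair.2).map fun _ => true) ++ (false ::
      ((List.range (w n)).map fun j => i / 2 ^ j % 2 == 1))))

lemma primrec_two_pow : Primrec fun j : ℕ => 2 ^ j := by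
  refine (Primrec.nat_rec₁ (f := fun _ a : ℕ => 2 * a) 1
    (Primrec.nat_double.comp Primrec.snd)).of_eq fun n => ?_
  induction n with
  | zero => rfl
  | succ n ih => rw [pow_succ', ← ih]

lemma primrec_codeWord {w : ℕ → ℕ} (hw : Primrec w) : Primrec₂ (codeWord w) := by
  have hunary {f : ℕ × ℕ → ℕ} (hf : Primrec f) :
      Primrec fun a : ℕ × ℕ => (List.range (f a)).map fun _ => true :=
    Primrec.list_map (Primrec.list_range.comp hf) (Primrec.const true)
  have hu : Primrec fun a : ℕ × ℕ => a.1.unpair := Primrec.unpair.comp Primrec.fst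
  refine Primrec.list_append.comp (hunary (Primrec.fst.comp hu))
    (Primrec.list_cons.comp (Primrec.const false) (Primrec.list_append.comp
      (hunary (Primrec.snd.comp hu)) (Primrec.list_cons.comp (Primrec.const false)
        (Primrec.list_map (Primrec.list_range.comp (hw.comp Primrec.fst)) ?_))))
  refine Primrec.beq.comp (Primrec.nat_mod.comp (Primrec.nat_div.comp
    (Primrec.snd.comp Primrec.fst) (primrec_two_pow.comp Primrec.snd)) (Primrec.const 2))
    (Primrec.const 1)

lemma length_codeWord_le (w : ℕ → ℕ) (n i : ℕ) :
    (codeWord w n i).length ≤ 2 * n.sqrt + w n + 2 := by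
  have h : n.unpair.1 ≤ n.sqrt ∧ n.unpair.2 ≤ n.sqrt := by
    have := Nat.sqrt_le_add n
    unfold Nat.unpair
    dsimp only
    split_ifs <;> simp only <;> omega
  simp [codeWord]
  omega

lemma unary_prefix {a b : ℕ} {s t : Str}
    (h : ((List.range a).map fun _ => true) ++ (false :: s) <+:
      ((List.range b).map fun _ => true) ++ (false :: t)) : a = b ∧ s <+: t := by
  simp only [List.map_const', List.length_range] at h
  induction a generalizing b with
  | zero =>
    cases b with
    | zero => simpa using h
    | succ b => simp [List.replicate_succ] at h
  | succ a ih =>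
    cases b with
    | zero => simp [List.replicate_succ] at h
    | succ b =>
      simp only [List.replicate_succ, List.cons_append, List.cons_prefix_cons, true_and] at h
      simpa using ih h

lemma codeWord_prefix {w : ℕ → ℕ} {n m i j : ℕ} (h : codeWord w n i <+: codeWord w m j) :
    n = m ∧ codeWord w n i = codeWord w m j := by
  obtain ⟨h₁, h'⟩ := unary_prefix h
  obtain ⟨h₂, -⟩ := unary_prefix h'
  have hnm : n = m := by
    rw [← Nat.pair_unpair n, ← Nat.pair_unpair m, h₁, h₂]
  refine ⟨hnm, h.eq_of_length ?_⟩
  subst hnm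
  simp [codeWord]

lemma codeWord_inj {w : ℕ → ℕ} {n m i j : ℕ} (hi : i < 2 ^ w n) (hj : j < 2 ^ w m)
    (h : codeWord w n i = codeWord w m j) : n = m ∧ i = j := by
  obtain ⟨rfl, -⟩ := codeWord_prefix (h ▸ List.prefix_rfl : codeWord w n i <+: codeWord w m j)
  refine ⟨rfl, ?_⟩
  simp only [codeWord, List.append_cancel_left_eq, List.cons.injEq, true_and,
    List.map_inj_left, List.mem_range] at h
  refine Nat.eq_of_testBit_eq fun k => ?_
  by_cases hk : k < w n
  · have := h k hk
    rw [Nat.testBit_eq_decide_div_mod_eq, Nat.testBit_eq_decide_div_mod_eq]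
    exact this
  · have hp : 2 ^ w n ≤ 2 ^ k := Nat.pow_le_pow_right (by norm_num) (by omega)
    rw [Nat.testBit_lt_two_pow (hi.trans_le hp), Nat.testBit_lt_two_pow (hj.trans_le hp)]

/-- The machine sending `codeWord w n i` to the `i`-th string of length `n` enumerated by `e`. -/
def indexMachine (e : ℕ → Option Str) (w : ℕ → ℕ) (p : Str) : Part Str :=
  Nat.rfindOpt fun m =>
    if codeWord w m.unpair.1 m.unpair.2.unpair.1 = p ∧ m.unpair.2.unpair.1 < 2 ^ w m.unpair.1 then
      (enumList e m.unpair.1 m.unpair.2.unpair.2)[m.unpair.2.unpair.1]?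
    else none

lemma partrec_indexMachine {e : ℕ → Option Str} {w : ℕ → ℕ} (he : Primrec e) (hw : Primrec w) :
    Partrec (indexMachine e w) := by
  refine Partrec.rfindOpt (Primrec.to_comp ?_)
  have hn : Primrec fun a : Str × ℕ => a.2.unpair.1 :=
    Primrec.fst.comp (Primrec.unpair.comp Primrec.snd)
  have hik : Primrec fun a : Str × ℕ => a.2.unpair.2.unpair :=
    Primrec.unpair.comp (Primrec.snd.comp (Primrec.unpair.comp Primrec.snd))
  have hi := Primrec.fst.comp hik
  refine Primrec.ite (PrimrecPred.and ?_ ?_) ?_ (Primrec.const none)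
  · exact Primrec.eq.comp ((primrec_codeWord hw).comp hn hi) Primrec.fst
  · exact Primrec.nat_lt.comp hi (primrec_two_pow.comp (hw.comp hn))
  · exact Primrec.list_getElem?.comp ((primrec_enumList he).comp hn (Primrec.snd.comp hik)) hi

lemma exists_of_mem_indexMachine {e : ℕ → Option Str} {w : ℕ → ℕ} {p σ : Str}
    (h : σ ∈ indexMachine e w p) :
    ∃ n i k, codeWord w n i = p ∧ i < 2 ^ w n ∧ (enumList e n k)[i]? = some σ := by
  obtain ⟨m, hm⟩ := Nat.rfindOpt_spec h
  rw [Option.mem_def] at hm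
  split_ifs at hm with hc
  exact ⟨_, _, _, hc.1, hc.2, hm⟩

lemma mem_indexMachine {e : ℕ → Option Str} {w : ℕ → ℕ} {n i k : ℕ} {σ : Str}
    (hi : i < 2 ^ w n) (h : (enumList e n k)[i]? = some σ) :
    σ ∈ indexMachine e w (codeWord w n i) := by
  have hdom : (indexMachine e w (codeWord w n i)).Dom := by
    refine Nat.rfindOpt_dom.2 ⟨Nat.pair n (Nat.pair i k), σ, ?_⟩
    simp [hi, h]
  obtain ⟨τ, hτ⟩ := Part.dom_iff_mem.1 hdom
  obtain ⟨m, j, l, hc, hj, hl⟩ := exists_of_mem_indexMachine hτ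
  obtain ⟨rfl, rfl⟩ := codeWord_inj hj hi hc
  have hmono {k l : ℕ} {σ τ : Str} (hkl : k ≤ l) (hσ : (enumList e m k)[j]? = some σ)
      (hτ : (enumList e m l)[j]? = some τ) : σ = τ := by
    have := (List.prefix_iff_getElem?.1 (enumList_prefix e m hkl)) j
      (List.getElem?_eq_some_iff.1 hσ).1
    rw [hτ, (List.getElem?_eq_some_iff.1 hσ).2] at this
    exact (Option.some.inj this).symm
  have : σ = τ := by
    rcases le_total k l with hkl | hkl
    · exact hmono hkl h hl
    · exact (hmono hkl hl h).symm
  exact this ▸ hτ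

lemma prefixFree_indexMachine (e : ℕ → Option Str) (w : ℕ → ℕ) (p q : Str)
    (hp : (indexMachine e w p).Dom) (hq : (indexMachine e w q).Dom) (hpq : p <+: q) : p = q := by
  obtain ⟨_, hσ⟩ := Part.dom_iff_mem.1 hp
  obtain ⟨_, hτ⟩ := Part.dom_iff_mem.1 hq
  obtain ⟨n, i, -, rfl, -⟩ := exists_of_mem_indexMachine hσ
  obtain ⟨m, j, -, rfl, -⟩ := exists_of_mem_indexMachine hτ
  exact (codeWord_prefix hpq).2

/-- If a c.e. set has at most `2 ^ w n` elements of each length `n`, then its elements of length `n`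
have programs of length at most `w n + O(√n)`. -/
lemma PrefixFreeUniversal.exists_program {V : Str →. Str} (hV : PrefixFreeUniversal V) {S : Set Str}
    (hS : CE S) {w : ℕ → ℕ} (hw : Primrec w)
    (hcard : ∀ n (F : Finset Str), (∀ σ ∈ F, σ ∈ S ∧ σ.length = n) → F.card ≤ 2 ^ w n) :
    ∃ c : ℕ, ∀ σ ∈ S, ∃ q, σ ∈ V q ∧ q.length ≤ 2 * σ.length.sqrt + w σ.length + c := by
  obtain ⟨e, he, heS⟩ := hS.exists_enum
  obtain ⟨c, hc⟩ := hV.2.2 _ (partrec_indexMachine he hw) (prefixFree_indexMachine e w)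
  refine ⟨c + 2, fun σ hσ => ?_⟩
  obtain ⟨k, hk⟩ := (heS σ).1 hσ
  obtain ⟨i, hi, hiσ⟩ := List.getElem_of_mem (mem_enumList_succ hk)
  have hlt : i < 2 ^ w σ.length := by
    refine hi.trans_le ?_
    rw [← List.toFinset_card_of_nodup (enumList_nodup e σ.length (k + 1))]
    refine hcard _ _ fun τ hτ => ?_
    obtain ⟨h₁, h₂⟩ := mem_enumList (List.mem_toFinset.1 hτ)
    exact ⟨(heS τ).2 h₂, h₁⟩
  obtain ⟨q, hq, hlen⟩ := hc σ _ (mem_indexMachine hlt (List.getElem?_eq_some_iff.2 ⟨hi, hiσ⟩))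
  exact ⟨q, hq, by have := length_codeWord_le w σ.length i; omega⟩

lemma Kpf_le {V : Str →. Str} {σ q : Str} (h : σ ∈ V q) : Kpf V σ ≤ q.length :=
  Nat.sInf_le ⟨q, rfl, h⟩

lemma ce_univ : CE Set.univ := by
  refine ⟨fun n => ((Encodable.decode n : Option Str) : Part Str),
    Computable.ofOption Computable.decode, fun σ => ?_⟩
  simp only [Set.mem_univ, true_iff]
  exact ⟨Encodable.encode σ, by simp⟩

/-- Every string `σ` has a program of length at most `|σ| + O(√|σ|)`. -/
lemma PrefixFreeUniversal.exists_program_univ {V : Str →. Str} (hV : PrefixFreeUniversal V) :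
    ∃ c : ℕ, ∀ σ, ∃ q, σ ∈ V q ∧ q.length ≤ 2 * σ.length.sqrt + σ.length + c := by
  obtain ⟨c, hc⟩ := hV.exists_program ce_univ (w := fun n => n) Primrec.id fun n F hF => by
    have := Finset.card_filter_length_eq_le (T := F) (s := n)
    rw [Finset.filter_true_of_mem fun σ hσ => (hF σ hσ).2] at this
    simpa using this
  exact ⟨c, fun σ => hc σ trivial⟩

/-- The shortest program of a string. -/
lemma PrefixFreeUniversal.exists_shortest_program {V : Str →. Str} (hV : PrefixFreeUniversal V)
    (σ : Str) : ∃ q, q.length = Kpf V σ ∧ σ ∈ V q := by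
  obtain ⟨c, hc⟩ := hV.exists_program_univ
  obtain ⟨q, hq, -⟩ := hc σ
  exact Nat.sInf_mem (s := {l : ℕ | ∃ p : Str, p.length = l ∧ σ ∈ V p}) ⟨_, q, rfl, hq⟩

lemma length_pre (x : ℕ → Bool) (n : ℕ) : (pre x n).length = n := by
  simp [pre]

/-- The strings whose complexity is below a fixed rational multiple of their length. -/
lemma ce_Kpf_lt {V : Str →. Str} (hV : PrefixFreeUniversal V) (a b : ℕ) :
    CE {σ | b * Kpf V σ < a * σ.length} := by
  refine ⟨fun n => ((Encodable.decode n : Option Str) : Part Str).bind fun p => (V p).bind fun σ =>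
    ((if b * p.length < a * σ.length then some σ else none : Option Str) : Part Str), ?_, ?_⟩
  · refine (Computable.ofOption Computable.decode).bind ?_
    refine Partrec.bind (hV.1.comp Computable.snd) (Computable.ofOption (Primrec.to_comp ?_))
    refine Primrec.ite (Primrec.nat_lt.comp ?_ ?_) (Primrec.option_some.comp Primrec.snd)
      (Primrec.const none)
    · exact Primrec.nat_mul.comp (Primrec.const b)
        (Primrec.list_length.comp (Primrec.snd.comp Primrec.fst))
    · exact Primrec.nat_mul.comp (Primrec.const a) (Primrec.list_length.comp Primrec.snd)
  · intro σ
    simp only [Set.mem_ofPred_eq, Part.mem_bind_iff, Part.mem_ofOption, Option.mem_def]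
    constructor
    · intro h
      obtain ⟨q, hq, hσ⟩ := hV.exists_shortest_program σ
      exact ⟨Encodable.encode q, q, by simp, σ, hσ, by simp [hq, h]⟩
    · rintro ⟨n, p, -, τ, hτ, h⟩
      split_ifs at h with hlt
      obtain rfl := Option.some.inj h
      exact (Nat.mul_le_mul_left b (Kpf_le hτ)).trans_lt hlt

lemma summable_Kpf_lt {V : Str →. Str} (hV : PrefixFreeUniversal V) {S : Set Str} {s : ℝ}
    (hS : ∀ σ ∈ S, (Kpf V σ : ℝ) ≤ s * σ.length) :
    Summable fun σ : S => (2 : ℝ) ^ (-s * ((σ : Str).length : ℝ)) := by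
  choose q hq hσ using hV.exists_shortest_program
  have hinj : Function.Injective q := fun σ τ h =>
    Part.mem_unique (hσ σ) (h ▸ hσ τ)
  refine summable_of_sum_le (c := 1) (fun σ => by positivity) fun F => ?_
  let f : S ↪ Str := ⟨fun σ => q σ, hinj.comp Subtype.val_injective⟩
  calc ∑ σ ∈ F, (2 : ℝ) ^ (-s * ((σ : Str).length : ℝ))
      ≤ ∑ σ ∈ F, ((1 : ℝ) / 2) ^ (f σ).length := by
        refine Finset.sum_le_sum fun σ _ => ?_
        have : ((1 : ℝ) / 2) ^ (f σ).length = (2 : ℝ) ^ (-(Kpf V σ : ℝ)) := by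
          rw [Real.rpow_neg (by norm_num), Real.rpow_natCast, one_div, inv_pow]
          simp [f, hq]
        rw [this]
        refine Real.rpow_le_rpow_of_exponent_le (by norm_num) ?_
        linarith [hS σ σ.2]
    _ = ∑ p ∈ F.map f, ((1 : ℝ) / 2) ^ p.length := by simp
    _ ≤ 1 := by
        refine kraft_of_prefixFreeOn fun p hp p' hp' h => ?_
        obtain ⟨σ, -, rfl⟩ := Finset.mem_map.1 hp
        obtain ⟨τ, -, rfl⟩ := Finset.mem_map.1 hp'
        exact hV.2.1 _ _ (Part.dom_iff_mem.2 ⟨_, hσ σ⟩) (Part.dom_iff_mem.2 ⟨_, hσ τ⟩) h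

/-- The elements of a c.e. set with finite `s`-weight have programs of length
`s |σ| + O(√|σ|)`. -/
lemma PrefixFreeUniversal.Kpf_le_of_summable {V : Str →. Str} (hV : PrefixFreeUniversal V) {s : ℚ}
    (hs : 0 ≤ s) {S : Set Str} (hS : CE S)
    (hsum : Summable fun σ : S => (2 : ℝ) ^ (-(s : ℝ) * ((σ : Str).length : ℝ))) :
    ∃ c : ℝ, ∀ σ ∈ S, (Kpf V σ : ℝ) ≤ s * σ.length + 2 * √σ.length + c := by
  classical
  obtain ⟨d, hd⟩ := pow_unbounded_of_one_lt
    (∑' σ : S, (2 : ℝ) ^ (-(s : ℝ) * ((σ : Str).length : ℝ))) (one_lt_two (α := ℝ))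
  have hsn (n : ℕ) : (s : ℝ) * n = ((s.num.toNat * n : ℕ) : ℝ) / (s.den : ℕ) := by
    have h₁ : (s : ℝ) = (s.num.toNat : ℝ) / s.den := by
      have h : ((s.num.toNat : ℤ) : ℝ) = (s.num : ℝ) := by
        rw [Int.toNat_of_nonneg (Rat.num_nonneg.2 hs)]
      rw [← Int.cast_natCast, h]
      exact Rat.cast_def s
    rw [h₁]; push_cast; ring
  have hle (n : ℕ) : ((s.num.toNat * n / s.den : ℕ) : ℝ) ≤ s * n := by
    rw [hsn]; exact Nat.cast_div_le
  have hlt (n : ℕ) : (s : ℝ) * n < (s.num.toNat * n / s.den : ℕ) + 1 := by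
    rw [hsn, ← Nat.floor_div_eq_div (K := ℝ)]; exact Nat.lt_floor_add_one _
  obtain ⟨c, hc⟩ := hV.exists_program hS (w := fun n => s.num.toNat * n / s.den + 1 + d)
    (Primrec.nat_add.comp (Primrec.succ.comp (Primrec.nat_div.comp (Primrec.nat_mul.comp
      (Primrec.const _) Primrec.id) (Primrec.const _))) (Primrec.const d)) fun n F hF => by
    have h₁ : ∑ σ ∈ F.subtype (· ∈ S), (2 : ℝ) ^ (-(s : ℝ) * ((σ : Str).length : ℝ)) =
        F.card * (2 : ℝ) ^ (-((s : ℝ) * n)) := by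
      rw [Finset.sum_subtype_of_mem (p := (· ∈ S))
        (fun σ : Str => (2 : ℝ) ^ (-(s : ℝ) * (σ.length : ℝ))) fun σ hσ => (hF σ hσ).1,
        Finset.sum_congr rfl fun σ hσ => by rw [(hF σ hσ).2]]
      simp
    have h₂ := (hsum.sum_le_tsum (F.subtype (· ∈ S)) fun σ _ => by positivity).trans hd.le
    rw [h₁, Real.rpow_neg (by norm_num), ← div_eq_mul_inv, div_le_iff₀ (by positivity)] at h₂
    have h₃ : (2 : ℝ) ^ ((s : ℝ) * n) ≤ 2 ^ (s.num.toNat * n / s.den + 1) := by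
      rw [← Real.rpow_natCast]
      exact Real.rpow_le_rpow_of_exponent_le (by norm_num) (by push_cast; exact (hlt n).le)
    have h₄ : (F.card : ℝ) ≤ 2 ^ (s.num.toNat * n / s.den + 1 + d) := by
      rw [pow_add _ _ d, mul_comm]
      exact h₂.trans (by gcongr)
    exact_mod_cast h₄
  refine ⟨1 + d + c, fun σ hσ => ?_⟩
  obtain ⟨q, hq, hlen⟩ := hc σ hσ
  have h₁ : (Kpf V σ : ℝ) ≤
      2 * σ.length.sqrt + ((s.num.toNat * σ.length / s.den : ℕ) + 1 + d) + c := by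
    exact_mod_cast (Kpf_le hq).trans hlen
  have h₂ : (σ.length.sqrt : ℝ) ≤ √σ.length := Real.nat_sqrt_le_real_sqrt
  linarith [hle σ.length]

lemma tendsto_add_sqrt_div (s c : ℝ) :
    Filter.Tendsto (fun n : ℕ => (s * n + 2 * √n + c) / n) Filter.atTop (nhds s) := by
  have h₁ : Filter.Tendsto (fun n : ℕ => (√(n : ℝ))⁻¹) Filter.atTop (nhds 0) :=
    (Real.tendsto_sqrt_atTop.comp tendsto_natCast_atTop_atTop).inv_tendsto_atTop
  have h₂ : Filter.Tendsto (fun n : ℕ => (n : ℝ)⁻¹) Filter.atTop (nhds 0) :=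
    tendsto_natCast_atTop_atTop.inv_tendsto_atTop
  have := ((h₁.const_mul 2).add (h₂.const_mul c)).const_add s
  simp only [mul_zero, add_zero] at this
  refine this.congr' ?_
  filter_upwards [Filter.eventually_gt_atTop 0] with n hn
  have hn' : (0 : ℝ) < n := by exact_mod_cast hn
  have hsq := Real.mul_self_sqrt hn'.le
  have : (√(n : ℝ))⁻¹ = √n / n := by
    rw [inv_eq_one_div, div_eq_div_iff (Real.sqrt_pos.2 hn').ne' hn'.ne', hsq, one_mul]
  rw [this]
  field_simp
  ring

lemma PrefixFreeUniversal.eventually_Kpf_div_le {V : Str →. Str} (hV : PrefixFreeUniversal V)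
    (x : ℕ → Bool) : ∀ᶠ n : ℕ in Filter.atTop, (Kpf V (pre x n) : ℝ) / n ≤ 2 := by
  obtain ⟨c, hc⟩ := hV.exists_program_univ
  filter_upwards [(tendsto_add_sqrt_div 1 c).eventually (gt_mem_nhds one_lt_two)] with n hn
  refine le_trans ?_ hn.le
  obtain ⟨q, hq, hlen⟩ := hc (pre x n)
  rw [length_pre] at hlen
  have h₁ : (Kpf V (pre x n) : ℝ) ≤ 2 * n.sqrt + n + c := by exact_mod_cast (Kpf_le hq).trans hlen
  have h₂ : (n.sqrt : ℝ) ≤ √n := Real.nat_sqrt_le_real_sqrt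
  gcongr
  linarith

/-- the effective Hausdorff dimension of `x` (defined via computably
enumerable covers) equals `liminf K(x↾n)/n`. -/
theorem stmt13 (V : Str →. Str) (hV : PrefixFreeUniversal V) (x : ℕ → Bool) :
    sInf {r : ℝ | ∃ s : ℚ, 0 ≤ s ∧ r = (s : ℝ) ∧ ∃ S : Set Str, CE S ∧
        Summable (fun σ : S => (2 : ℝ) ^ (-(s : ℝ) * ((σ : Str).length : ℝ))) ∧
        {n : ℕ | pre x n ∈ S}.Infinite} =
      Filter.liminf (fun n : ℕ => (Kpf V (pre x n) : ℝ) / (n : ℝ)) Filter.atTop := by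
  set u : ℕ → ℝ := fun n => (Kpf V (pre x n) : ℝ) / (n : ℝ) with hu
  have hu0 (n : ℕ) : 0 ≤ u n := by positivity
  have hbdd : Filter.IsBoundedUnder (· ≤ ·) Filter.atTop u := ⟨2, hV.eventually_Kpf_div_le x⟩
  have hbdd' : Filter.IsBoundedUnder (· ≥ ·) Filter.atTop u :=
    Filter.isBoundedUnder_of ⟨0, hu0⟩
  have ht0 : 0 ≤ Filter.liminf u Filter.atTop :=
    Filter.le_liminf_of_le hbdd.isCoboundedUnder_ge (Filter.Eventually.of_forall hu0)
  have hmem (s : ℚ) (hs : Filter.liminf u Filter.atTop < s) :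
      (s : ℝ) ∈ {r : ℝ | ∃ s : ℚ, 0 ≤ s ∧ r = (s : ℝ) ∧ ∃ S : Set Str, CE S ∧
        Summable (fun σ : S => (2 : ℝ) ^ (-(s : ℝ) * ((σ : Str).length : ℝ))) ∧
        {n : ℕ | pre x n ∈ S}.Infinite} := by
    have hs0 : 0 ≤ s := by exact_mod_cast ht0.trans hs.le
    have hiff (σ : Str) : s.den * Kpf V σ < s.num.toNat * σ.length ↔
        (Kpf V σ : ℝ) < s * σ.length := by
      have hnum : ((s.num.toNat : ℕ) : ℝ) = s.num := by
        exact_mod_cast congrArg (Int.cast (R := ℝ)) (Int.toNat_of_nonneg (Rat.num_nonneg.2 hs0))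
      have hden : (0 : ℝ) < s.den := by exact_mod_cast s.den_pos
      rw [← Nat.cast_lt (α := ℝ), Rat.cast_def s]
      push_cast
      rw [hnum, div_mul_eq_mul_div, lt_div_iff₀ hden, mul_comm (Kpf V σ : ℝ)]
    refine ⟨s, hs0, rfl, _, ce_Kpf_lt hV s.num.toNat s.den,
      summable_Kpf_lt hV fun σ hσ => ((hiff σ).1 hσ).le, ?_⟩
    rw [← Nat.frequently_atTop_iff_infinite]
    refine ((Filter.frequently_lt_of_liminf_lt hbdd.isCoboundedUnder_ge hs).and_eventually
      (Filter.eventually_gt_atTop 0)).mono fun n hn => ?_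
    refine (hiff _).2 ?_
    rw [length_pre]
    exact (div_lt_iff₀ (by exact_mod_cast hn.2)).1 hn.1
  apply le_antisymm
  · refine le_of_forall_gt_imp_ge_of_dense fun r hr => ?_
    obtain ⟨s, hs, hsr⟩ := exists_rat_btwn hr
    refine (csInf_le ⟨0, ?_⟩ (hmem s hs)).trans hsr.le
    rintro _ ⟨s', hs', rfl, -⟩
    exact_mod_cast hs'
  · obtain ⟨s₀, hs₀⟩ := exists_rat_gt (Filter.liminf u Filter.atTop)
    refine le_csInf ⟨_, hmem s₀ hs₀⟩ ?_
    rintro _ ⟨s, hs, rfl, S, hS, hsum, hinf⟩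
    obtain ⟨c, hc⟩ := hV.Kpf_le_of_summable hs hS hsum
    refine le_of_forall_gt_imp_ge_of_dense fun r hr => ?_
    refine Filter.liminf_le_of_frequently_le ?_ hbdd'
    refine ((Nat.frequently_atTop_iff_infinite.2 hinf).and_eventually
      ((tendsto_add_sqrt_div s c).eventually (gt_mem_nhds hr))).mono fun n hn => ?_
    refine le_trans ?_ hn.2.le
    have := hc _ hn.1
    rw [length_pre] at this
    exact div_le_div_of_nonneg_right this (Nat.cast_nonneg n)
end
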